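/- There is no derivation f of n₂₈, no λ ∈ ℝ∖{0}, no c ∈ ℝ, and no β ∈ span{e¹,e²,e³,e⁴} such that, with ω = λ²ω₀, ρ = λ³ρ₀, and ν = ce¹² + (λ³−c)e³⁴ + λ³e⁵⁶ + e⁵∧β + e⁶∧J₀*β, the equations f.ν = ω and ω∧(f.ω − ν) = dρ̂ hold, where ρ̂ = λ³(e¹³⁵ − e¹⁴⁶ − e²³⁶ − e²⁴⁵). Consequently no almost nilpotent Lie algebra with codimension-one nilpotent ideal isomorphic to n₂₈ admits a closed G2-eigenform. -/

import Mathlib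

open Module

/-- Wedge product of `k` covectors, as an alternating `k`-form (determinant convention). -/
noncomputable def wedgeCov {V : Type*} [AddCommGroup V] [Module ℝ V] {k : ℕ}
    (f : Fin k → Module.Dual ℝ V) : V [⋀^Fin k]→ₗ[ℝ] ℝ :=
  Matrix.detRowAlternating.compLinearMap (LinearMap.pi f)

/-- Wedge product of alternating forms (shuffle convention, compatible with `wedgeCov`). -/
noncomputable def aw {V : Type*} [AddCommGroup V] [Module ℝ V] {a b : ℕ}
    (ω : V [⋀^Fin a]→ₗ[ℝ] ℝ) (σ : V [⋀^Fin b]→ₗ[ℝ] ℝ) : V [⋀^Fin (a + b)]→ₗ[ℝ] ℝ :=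
  ((TensorProduct.lid ℝ ℝ).toLinearMap.compAlternatingMap (ω.domCoprod σ)).domDomCongr
    finSumFinEquiv

/-- The `i`-th coordinate covector on `Fin n → ℝ`. -/
noncomputable def pr {n : ℕ} (i : Fin n) : Module.Dual ℝ (Fin n → ℝ) := LinearMap.proj i

/-- The model `G₂` three-form `φ₀ = ω₀ ∧ e⁷ + ρ₀ = e¹²⁷ + e³⁴⁷ + e⁵⁶⁷ + e¹³⁵ − e¹⁴⁶ − e²³⁶ − e²⁴⁵`
on `ℝ⁷` (all indices 0-based). -/
noncomputable def phi0 : (Fin 7 → ℝ) [⋀^Fin 3]→ₗ[ℝ] ℝ :=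
  wedgeCov ![pr 0, pr 1, pr 6] + wedgeCov ![pr 2, pr 3, pr 6] + wedgeCov ![pr 4, pr 5, pr 6] +
    wedgeCov ![pr 0, pr 2, pr 4] - wedgeCov ![pr 0, pr 3, pr 5] - wedgeCov ![pr 1, pr 2, pr 5] -
    wedgeCov ![pr 1, pr 3, pr 4]

/-- A three-form on a real vector space is a `G₂`-structure if it is linearly
equivalent to the model form `φ₀`. -/
def IsG2 {V : Type*} [AddCommGroup V] [Module ℝ V] (φ : V [⋀^Fin 3]→ₗ[ℝ] ℝ) : Prop :=
  ∃ u : V ≃ₗ[ℝ] (Fin 7 → ℝ), φ = phi0.compLinearMap u.toLinearMap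

/-- Chevalley–Eilenberg differential of a 2-form, relative to a bracket `B`, evaluated
pointwise: `dν(x,y,z) = −ν(B x y, z) + ν(B x z, y) − ν(B y z, x)`. -/
noncomputable def d2CE {V : Type*} [AddCommGroup V] [Module ℝ V] (B : V → V → V)
    (ν : V [⋀^Fin 2]→ₗ[ℝ] ℝ) (x y z : V) : ℝ :=
  -ν ![B x y, z] + ν ![B x z, y] - ν ![B y z, x]

/-- Chevalley–Eilenberg differential of a 3-form, relative to a bracket `B`, evaluated
pointwise. -/
noncomputable def d3CE {V : Type*} [AddCommGroup V] [Module ℝ V] (B : V → V → V)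
    (ρ : V [⋀^Fin 3]→ₗ[ℝ] ℝ) (x y z w : V) : ℝ :=
  -ρ ![B x y, z, w] + ρ ![B x z, y, w] - ρ ![B x w, y, z]
    - ρ ![B y z, x, w] + ρ ![B y w, x, z] - ρ ![B z w, x, y]

/-- Chevalley–Eilenberg differential of a 4-form, relative to a bracket `B`, evaluated
pointwise. -/
noncomputable def d4CE {V : Type*} [AddCommGroup V] [Module ℝ V] (B : V → V → V)
    (σ : V [⋀^Fin 4]→ₗ[ℝ] ℝ) (a b c d e : V) : ℝ :=
  -σ ![B a b, c, d, e] + σ ![B a c, b, d, e] - σ ![B a d, b, c, e] + σ ![B a e, b, c, d]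
    - σ ![B b c, a, d, e] + σ ![B b d, a, c, e] - σ ![B b e, a, c, d]
    - σ ![B c d, a, b, e] + σ ![B c e, a, b, d] - σ ![B d e, a, b, c]

/-- The Lie bracket of the six-dimensional nilpotent Lie algebra `n₂₈ = (0,0,0,0,13+42,14+23)`
(0-based coordinates on `ℝ⁶`): dual to `de⁵ = e¹³ + e⁴²`, `de⁶ = e¹⁴ + e²³`. -/
noncomputable def B28 (x y : Fin 6 → ℝ) : Fin 6 → ℝ :=
  ![0, 0, 0, 0, -(x 0 * y 2 - x 2 * y 0 + x 3 * y 1 - x 1 * y 3),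
    -(x 0 * y 3 - x 3 * y 0 + x 1 * y 2 - x 2 * y 1)]

/-- The model four-form `⋆_{φ₀}φ₀` on `ℝ⁷` (0-based indices). -/
noncomputable def star0 : (Fin 7 → ℝ) [⋀^Fin 4]→ₗ[ℝ] ℝ :=
  wedgeCov ![pr 0, pr 1, pr 2, pr 3] + wedgeCov ![pr 0, pr 1, pr 4, pr 5] +
    wedgeCov ![pr 2, pr 3, pr 4, pr 5] + wedgeCov ![pr 0, pr 2, pr 5, pr 6] +
    wedgeCov ![pr 0, pr 3, pr 4, pr 6] + wedgeCov ![pr 1, pr 2, pr 4, pr 6] -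
    wedgeCov ![pr 1, pr 3, pr 5, pr 6]

/-- The almost complex structure `J₀` of `n₂₈`:
`J₀e₁ = e₂`, `J₀e₃ = e₄`, `J₀e₅ = −e₆` (0-based coordinates). -/
noncomputable def J19 : (Fin 6 → ℝ) →ₗ[ℝ] (Fin 6 → ℝ) :=
  Matrix.toLin' !![0, -1, 0, 0, 0, 0;
                   1, 0, 0, 0, 0, 0;
                   0, 0, 0, -1, 0, 0;
                   0, 0, 1, 0, 0, 0;
                   0, 0, 0, 0, 0, 1;
                   0, 0, 0, 0, -1, 0]

/-- `ω = λ²ω₀ = λ²(−e¹² − e³⁴ + e⁵⁶)` (0-based). -/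
noncomputable def om19 (lam : ℝ) : (Fin 6 → ℝ) [⋀^Fin 2]→ₗ[ℝ] ℝ :=
  lam ^ 2 • (-(wedgeCov ![pr 0, pr 1]) - wedgeCov ![pr 2, pr 3] + wedgeCov ![pr 4, pr 5])

/-- `ν = ce¹² + (λ³−c)e³⁴ + λ³e⁵⁶ + e⁵ ∧ β + e⁶ ∧ J₀*β` (0-based). -/
noncomputable def nu19 (lam c : ℝ) (β : Module.Dual ℝ (Fin 6 → ℝ)) :
    (Fin 6 → ℝ) [⋀^Fin 2]→ₗ[ℝ] ℝ :=
  c • wedgeCov ![pr 0, pr 1] + (lam ^ 3 - c) • wedgeCov ![pr 2, pr 3] +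
    lam ^ 3 • wedgeCov ![pr 4, pr 5] + wedgeCov ![pr 4, β] +
    wedgeCov ![pr 5, β.comp J19]

/-- `ρ̂ = λ³(e¹³⁵ − e¹⁴⁶ − e²³⁶ − e²⁴⁵)` (0-based). -/
noncomputable def rhh19 (lam : ℝ) : (Fin 6 → ℝ) [⋀^Fin 3]→ₗ[ℝ] ℝ :=
  lam ^ 3 • (wedgeCov ![pr 0, pr 2, pr 4] - wedgeCov ![pr 0, pr 3, pr 5] -
    wedgeCov ![pr 1, pr 2, pr 5] - wedgeCov ![pr 1, pr 3, pr 4])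

/-- The wedge product of two 2-forms (given as functions), evaluated on four vectors. -/
noncomputable def sh2 {V : Type*} (f g : V → V → ℝ) (a b c d : V) : ℝ :=
  f a b * g c d - f a c * g b d + f a d * g b c + f b c * g a d - f b d * g a c +
    f c d * g a b

/-- The action `(f.ω)(x,y) = −ω(fx,y) − ω(x,fy)` of an endomorphism on a 2-form. -/
noncomputable def fdot2 {V : Type*} [AddCommGroup V] [Module ℝ V] (f : V →ₗ[ℝ] V)
    (ω : V [⋀^Fin 2]→ₗ[ℝ] ℝ) (x y : V) : ℝ :=
  -(ω ![f x, y]) - ω ![x, f y]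

theorem wedgeCov_two {V : Type*} [AddCommGroup V] [Module ℝ V] (a b : Module.Dual ℝ V) (x y : V) :
    wedgeCov ![a, b] ![x, y] = a x * b y - b x * a y := by
  change Matrix.det (Matrix.of fun i j => (![a, b] j) (![x, y] i)) = _
  rw [Matrix.det_fin_two]; simp

theorem wedgeCov_three {V : Type*} [AddCommGroup V] [Module ℝ V] (a b c : Module.Dual ℝ V)
    (x y z : V) :
    wedgeCov ![a, b, c] ![x, y, z] = a x * (b y * c z - c y * b z) -
      b x * (a y * c z - c y * a z) + c x * (a y * b z - b y * a z) := by
  change Matrix.det (Matrix.of fun i j => (![a, b, c] j) (![x, y, z] i)) = _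
  rw [Matrix.det_fin_three]; simp; ring

theorem wedgeCov_four {V : Type*} [AddCommGroup V] [Module ℝ V] (a b c d : Module.Dual ℝ V)
    (x y z w : V) :
    wedgeCov ![a, b, c, d] ![x, y, z, w] =
      (a x * b y - b x * a y) * (c z * d w - d z * c w) -
      (a x * c y - c x * a y) * (b z * d w - d z * b w) +
      (a x * d y - d x * a y) * (b z * c w - c z * b w) +
      (b x * c y - c x * b y) * (a z * d w - d z * a w) -
      (b x * d y - d x * b y) * (a z * c w - c z * a w) +
      (c x * d y - d x * c y) * (a z * b w - b z * a w) := by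
  change Matrix.det (Matrix.of fun i j => (![a, b, c, d] j) (![x, y, z, w] i)) = _
  rw [Matrix.det_succ_row_zero]; simp [Fin.sum_univ_succ, Matrix.det_fin_three, Matrix.submatrix, Fin.succAbove]
  ring

theorem om19_apply (lam : ℝ) (x y : Fin 6 → ℝ) :
    om19 lam ![x, y] = lam ^ 2 * (-(x 0 * y 1 - x 1 * y 0) - (x 2 * y 3 - x 3 * y 2) +
      (x 4 * y 5 - x 5 * y 4)) := by
  simp [om19, wedgeCov_two, pr]; ring

theorem map_eq_sum_single {n : ℕ} {W : Type*} [AddCommGroup W] [Module ℝ W]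
    (f : (Fin n → ℝ) →ₗ[ℝ] W) (x : Fin n → ℝ) :
    f x = ∑ i, x i • f (Pi.single i 1) := by
  conv_lhs => rw [pi_eq_sum_univ' x]
  simp only [map_sum, map_smul]

theorem J19_apply (x : Fin 6 → ℝ) : J19 x = ![-x 1, x 0, -x 3, x 2, x 5, -x 4] := by
  ext i; fin_cases i <;> simp [J19, Matrix.mulVec, dotProduct, Fin.sum_univ_succ]

theorem nu19_apply (lam c : ℝ) (β : Module.Dual ℝ (Fin 6 → ℝ))
    (h₄ : β (Pi.single 4 1) = 0) (h₅ : β (Pi.single 5 1) = 0) (x y : Fin 6 → ℝ) :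
    nu19 lam c β ![x, y] = c * (x 0 * y 1 - x 1 * y 0) + (lam ^ 3 - c) * (x 2 * y 3 - x 3 * y 2) +
      lam ^ 3 * (x 4 * y 5 - x 5 * y 4) +
      β (Pi.single 0 1) * (x 4 * y 0 - x 0 * y 4 - x 5 * y 1 + x 1 * y 5) +
      β (Pi.single 1 1) * (x 4 * y 1 - x 1 * y 4 + x 5 * y 0 - x 0 * y 5) +
      β (Pi.single 2 1) * (x 4 * y 2 - x 2 * y 4 - x 5 * y 3 + x 3 * y 5) +
      β (Pi.single 3 1) * (x 4 * y 3 - x 3 * y 4 + x 5 * y 2 - x 2 * y 5) := by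
  have h : ∀ v : Fin 6 → ℝ, β v = v 0 * β (Pi.single 0 1) + v 1 * β (Pi.single 1 1) +
      v 2 * β (Pi.single 2 1) + v 3 * β (Pi.single 3 1) := by
    intro v
    rw [map_eq_sum_single β v, Fin.sum_univ_six]
    simp [h₄, h₅]
  simp only [nu19, wedgeCov_two, pr, AlternatingMap.add_apply, AlternatingMap.smul_apply,
    LinearMap.comp_apply, J19_apply, LinearMap.proj_apply, smul_eq_mul, h x, h y,
    h ![_, _, _, _, _, _]]
  simp
  ring

theorem rhh19_apply (lam : ℝ) (x y z : Fin 6 → ℝ) :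
    rhh19 lam ![x, y, z] = lam ^ 3 *
      ((x 0 * (y 2 * z 4 - y 4 * z 2) - x 2 * (y 0 * z 4 - y 4 * z 0) +
          x 4 * (y 0 * z 2 - y 2 * z 0)) -
        (x 0 * (y 3 * z 5 - y 5 * z 3) - x 3 * (y 0 * z 5 - y 5 * z 0) +
          x 5 * (y 0 * z 3 - y 3 * z 0)) -
        (x 1 * (y 2 * z 5 - y 5 * z 2) - x 2 * (y 1 * z 5 - y 5 * z 1) +
          x 5 * (y 1 * z 2 - y 2 * z 1)) -
        (x 1 * (y 3 * z 4 - y 4 * z 3) - x 3 * (y 1 * z 4 - y 4 * z 1) +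
          x 4 * (y 1 * z 3 - y 3 * z 1))) := by
  simp only [rhh19, wedgeCov_three, pr, AlternatingMap.sub_apply, AlternatingMap.smul_apply,
    LinearMap.proj_apply, smul_eq_mul]

theorem no_derivation_n28 (f : (Fin 6 → ℝ) →ₗ[ℝ] (Fin 6 → ℝ))
    (hf : ∀ x y : Fin 6 → ℝ, f (B28 x y) = B28 (f x) y + B28 x (f y))
    (lam : ℝ) (hlam : lam ≠ 0) (c : ℝ) (β : Module.Dual ℝ (Fin 6 → ℝ))
    (h₄ : β (Pi.single 4 1) = 0) (h₅ : β (Pi.single 5 1) = 0)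
    (heq : ∀ x y z w : Fin 6 → ℝ,
      sh2 (fun a b => om19 lam ![a, b])
        (fun a b => fdot2 f (om19 lam) a b - nu19 lam c β ![a, b]) x y z w =
      d3CE B28 (rhh19 lam) x y z w) : False := by
  have D (i j : Fin 6) := hf (Pi.single i 1) (Pi.single j 1)
  have E (i j k l : Fin 6) :=
    heq (Pi.single i 1) (Pi.single j 1) (Pi.single k 1) (Pi.single l 1)
  simp only [sh2, fdot2, d3CE, nu19_apply lam c β h₄ h₅, om19_apply, rhh19_apply] at E
  have b02 : B28 (Pi.single 0 1) (Pi.single 2 1) = - Pi.single 4 1 := by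
    ext i; fin_cases i <;> simp [B28]
  have b03 : B28 (Pi.single 0 1) (Pi.single 3 1) = - Pi.single 5 1 := by
    ext i; fin_cases i <;> simp [B28]
  have b12 : B28 (Pi.single 1 1) (Pi.single 2 1) = - Pi.single 5 1 := by
    ext i; fin_cases i <;> simp [B28]
  have b13 : B28 (Pi.single 1 1) (Pi.single 3 1) = Pi.single 4 1 := by
    ext i; fin_cases i <;> simp [B28]
  have d02 := congrFun (D 0 2) 4
  have d03 := congrFun (D 0 3) 5
  have d12 := congrFun (D 1 2) 5
  have d13 := congrFun (D 1 3) 4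
  have g1 := E 0 1 2 3
  have g2 := E 0 1 4 5
  have g3 := E 2 3 4 5
  rw [b02, map_neg] at d02
  rw [b03, map_neg] at d03
  rw [b12, map_neg] at d12
  rw [b13] at d13
  clear D E b02 b03 b12 b13 hf heq
  simp [B28] at d02 d03 d12 d13 g1 g2 g3
  generalize f (Pi.single 0 1) = f0 at *
  generalize f (Pi.single 1 1) = f1 at *
  generalize f (Pi.single 2 1) = f2 at *
  generalize f (Pi.single 3 1) = f3 at *
  generalize f (Pi.single 4 1) = f4 at *
  generalize f (Pi.single 5 1) = f5 at *
  have hl : lam ^ 2 ≠ 0 := pow_ne_zero 2 hlam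
  have t1 : lam ^ 2 * (f0 0 + f1 1 + f2 2 + f3 3) = lam ^ 3 := by
    apply mul_left_cancel₀ hl; linear_combination -g1
  have hR : 2 * (f4 4 + f5 5) = 2 * (f0 0 + f1 1 + f2 2 + f3 3) := by linarith
  have t2 : lam ^ 2 * (2 * (f4 4 + f5 5)) + lam ^ 2 * (f0 0 + f1 1 + f2 2 + f3 3) + lam ^ 3 = 0 := by
    apply mul_left_cancel₀ hl; linear_combination g2 + g3
  rw [hR] at t2
  exact pow_ne_zero 3 hlam (by linarith)

/-- Representatives of the ten cosets of `Perm (Fin 2) × Perm (Fin 3)` in `Perm (Fin 2 ⊕ Fin 3)`. -/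
def shuffleTwoThree : Fin 10 → Equiv.Perm (Fin 2 ⊕ Fin 3) :=
  ![1, Equiv.swap (.inl 1) (.inr 0), Equiv.swap (.inl 1) (.inr 1), Equiv.swap (.inl 1) (.inr 2),
    Equiv.swap (.inl 0) (.inr 0), Equiv.swap (.inl 0) (.inr 1), Equiv.swap (.inl 0) (.inr 2),
    Equiv.swap (.inl 0) (.inr 0) * Equiv.swap (.inl 1) (.inr 1),
    Equiv.swap (.inl 0) (.inr 0) * Equiv.swap (.inl 1) (.inr 2),
    Equiv.swap (.inl 0) (.inr 1) * Equiv.swap (.inl 1) (.inr 2)]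

theorem shuffleTwoThree_bijective : Function.Bijective
    (fun i => (Quotient.mk'' (shuffleTwoThree i) : Equiv.Perm.ModSumCongr (Fin 2) (Fin 3))) := by
  rw [Fintype.bijective_iff_injective_and_card]
  constructor
  · intro i j h
    rw [Quotient.eq'', QuotientGroup.leftRel_apply] at h
    revert i j
    decide +kernel
  · have h := Subgroup.card_eq_card_quotient_mul_card_subgroup
      (Equiv.Perm.sumCongrHom (Fin 2) (Fin 3)).range
    rw [Nat.card_congr (MonoidHom.ofInjective
      (Equiv.Perm.sumCongrHom_injective (α := Fin 2) (β := Fin 3))).toEquiv.symm] at h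
    simp only [Nat.card_eq_fintype_card, Fintype.card_prod, Fintype.card_perm, Fintype.card_fin,
      Fintype.card_sum] at h
    rw [Fintype.card_fin, ← Nat.card_eq_fintype_card]
    change 10 = Nat.card (_ ⧸ (Equiv.Perm.sumCongrHom (Fin 2) (Fin 3)).range)
    norm_num [Nat.factorial] at h
    rw [← Nat.card_eq_fintype_card] at h
    generalize Nat.card (_ ⧸ (Equiv.Perm.sumCongrHom (Fin 2) (Fin 3)).range) = N at h ⊢
    omega

theorem aw_two_three_apply {V : Type*} [AddCommGroup V] [Module ℝ V]
    (τ : V [⋀^Fin 2]→ₗ[ℝ] ℝ) (φ : V [⋀^Fin 3]→ₗ[ℝ] ℝ) (a b c d e : V) :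
    (aw τ φ : V [⋀^Fin 5]→ₗ[ℝ] ℝ) ![a, b, c, d, e] =
      τ ![a, b] * φ ![c, d, e] - τ ![a, c] * φ ![b, d, e] - τ ![a, d] * φ ![c, b, e] -
        τ ![a, e] * φ ![c, d, b] - τ ![c, b] * φ ![a, d, e] - τ ![d, b] * φ ![c, a, e] -
        τ ![e, b] * φ ![c, d, a] + τ ![c, d] * φ ![a, b, e] + τ ![c, e] * φ ![a, d, b] +
        τ ![d, e] * φ ![c, a, b] := by
  set v := ![a, b, c, d, e] with hv
  have term (σ : Equiv.Perm (Fin 2 ⊕ Fin 3)) : TensorProduct.lid ℝ ℝ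
      (AlternatingMap.domCoprod.summand τ φ (Quotient.mk'' σ) (v ∘ finSumFinEquiv))
      = ((Equiv.Perm.sign σ : ℤ) : ℝ) *
        (τ (fun i => v (finSumFinEquiv (σ (.inl i)))) *
          φ (fun i => v (finSumFinEquiv (σ (.inr i))))) := by
    rw [AlternatingMap.domCoprod.summand_mk'']
    rcases Int.units_eq_one_or (Equiv.Perm.sign σ) with h | h <;> rw [h] <;>
      simp [MultilinearMap.domDomCongr_apply, MultilinearMap.domCoprod_apply]
  have key : (aw τ φ : V [⋀^Fin 5]→ₗ[ℝ] ℝ) v =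
      ∑ i, ((Equiv.Perm.sign (shuffleTwoThree i) : ℤ) : ℝ) *
        (τ (fun j => v (finSumFinEquiv (shuffleTwoThree i (.inl j)))) *
          φ (fun j => v (finSumFinEquiv (shuffleTwoThree i (.inr j))))) := by
    rw [aw, AlternatingMap.domDomCongr_apply, LinearMap.compAlternatingMap_apply, LinearEquiv.coe_coe]
    rw [AlternatingMap.domCoprod_apply, _root_.sum_apply, map_sum]
    symm
    refine Fintype.sum_bijective _ shuffleTwoThree_bijective _ _ fun i => ?_
    exact (term _).symm
  have fin2 (x : Fin 2 → V) : x = ![x 0, x 1] := by ext i; fin_cases i <;> rfl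
  have fin3 (x : Fin 3 → V) : x = ![x 0, x 1, x 2] := by ext i; fin_cases i <;> rfl
  rw [key]
  have t (i : Fin 10) : (τ (fun j => v (finSumFinEquiv (shuffleTwoThree i (.inl j))))) =
    τ ![v (finSumFinEquiv (shuffleTwoThree i (.inl 0))), v (finSumFinEquiv (shuffleTwoThree i (.inl 1)))] :=
    congrArg _ (fin2 _)
  have p (i : Fin 10) : (φ (fun j => v (finSumFinEquiv (shuffleTwoThree i (.inr j))))) =
    φ ![v (finSumFinEquiv (shuffleTwoThree i (.inr 0))), v (finSumFinEquiv (shuffleTwoThree i (.inr 1))), v (finSumFinEquiv (shuffleTwoThree i (.inr 2)))] :=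
    congrArg _ (fin3 _)
  simp only [t, p]
  have s (k : Fin 10) : (Equiv.Perm.sign (shuffleTwoThree k) : ℤ) = ![1,-1,-1,-1,-1,-1,-1,1,1,1] k := by
    revert k; decide +kernel
  have r (k : Fin 10) (j : Fin 5) : finSumFinEquiv (shuffleTwoThree k (finSumFinEquiv.symm j)) = (![![0,1,2,3,4],![0,2,1,3,4],![0,3,2,1,4],![0,4,2,3,1],![2,1,0,3,4],![3,1,2,0,4],![4,1,2,3,0],![2,3,0,1,4],![2,4,0,3,1],![3,4,2,0,1]] k : Fin 5 → Fin 5) j := by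
    revert k j; decide +kernel
  have r0 (k) := r k 0
  have r1 (k) := r k 1
  have r2 (k) := r k 2
  have r3 (k) := r k 3
  have r4 (k) := r k 4
  change ∀ k, finSumFinEquiv (shuffleTwoThree k (.inl 0)) = _ at r0
  change ∀ k, finSumFinEquiv (shuffleTwoThree k (.inl 1)) = _ at r1
  change ∀ k, finSumFinEquiv (shuffleTwoThree k (.inr 0)) = _ at r2
  change ∀ k, finSumFinEquiv (shuffleTwoThree k (.inr 1)) = _ at r3
  change ∀ k, finSumFinEquiv (shuffleTwoThree k (.inr 2)) = _ at r4
  simp only [r0, r1, r2, r3, r4, s]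
  simp [Fin.sum_univ_succ, hv]
  ring

theorem map_swap_two {V : Type*} [AddCommGroup V] [Module ℝ V]
    (τ : V [⋀^Fin 2]→ₗ[ℝ] ℝ) (x y : V) : τ ![x, y] = -τ ![y, x] := by
  rw [← τ.map_swap ![y, x] (show (0 : Fin 2) ≠ 1 by decide)]
  congr 1; ext i; fin_cases i <;> rfl

theorem map_swap_three_left {V : Type*} [AddCommGroup V] [Module ℝ V]
    (φ : V [⋀^Fin 3]→ₗ[ℝ] ℝ) (x y z : V) : φ ![x, y, z] = -φ ![y, x, z] := by
  rw [← φ.map_swap ![y, x, z] (show (0 : Fin 3) ≠ 1 by decide)]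
  congr 1; ext i; fin_cases i <;> rfl

theorem map_swap_three_right {V : Type*} [AddCommGroup V] [Module ℝ V]
    (φ : V [⋀^Fin 3]→ₗ[ℝ] ℝ) (x y z : V) : φ ![x, y, z] = -φ ![x, z, y] := by
  rw [← φ.map_swap ![x, z, y] (show (1 : Fin 3) ≠ 2 by decide)]
  congr 1; ext i; fin_cases i <;> rfl

theorem aw_two_three_apply' {V : Type*} [AddCommGroup V] [Module ℝ V]
    (τ : V [⋀^Fin 2]→ₗ[ℝ] ℝ) (φ : V [⋀^Fin 3]→ₗ[ℝ] ℝ) (a b c d e : V) :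
    (aw τ φ : V [⋀^Fin 5]→ₗ[ℝ] ℝ) ![a, b, c, d, e] =
      τ ![a, b] * φ ![c, d, e] - τ ![a, c] * φ ![b, d, e] + τ ![a, d] * φ ![b, c, e] -
        τ ![a, e] * φ ![b, c, d] + τ ![b, c] * φ ![a, d, e] - τ ![b, d] * φ ![a, c, e] +
        τ ![b, e] * φ ![a, c, d] + τ ![c, d] * φ ![a, b, e] - τ ![c, e] * φ ![a, b, d] +
        τ ![d, e] * φ ![a, b, c] := by
  rw [aw_two_three_apply, map_swap_two τ c b, map_swap_two τ d b, map_swap_two τ e b,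
    map_swap_three_left φ c b e, map_swap_three_right φ c d b, map_swap_three_left φ c b d,
    map_swap_three_left φ c a e, map_swap_three_right φ c d a, map_swap_three_left φ c a d,
    map_swap_three_right φ a d b, map_swap_three_left φ c a b, map_swap_three_right φ a c b]
  ring

/-- The closedness and eigenform equations in an adapted frame, as a quadratic system in the
remaining structure constants, force the eigenvalue to vanish. -/
theorem eq_zero_of_quadratic_system (p1 q1 q2 r1 r2 s1 x1 x2 y1 y2 t w a b : ℝ)
    (htr : p1 + s1 = t)
    (e11 : p1 * (2 * p1 - 4 * t) + r1 * (q1 + r1) - r2 * (q2 - r2) + (x1 ^ 2 + x2 ^ 2) = 6 * t ^ 2)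
    (e22 : s1 * (2 * s1 - 4 * t) + q1 * (q1 + r1) + q2 * (q2 - r2) + (y1 ^ 2 + y2 ^ 2) = 6 * t ^ 2)
    (e12 : (p1 + s1) * (q1 + r1) + w * (q2 - r2) + r1 * (2 * s1 - 4 * t) +
      q1 * (2 * p1 - 4 * t) + 2 * (x1 * y1 + x2 * y2) = 0)
    (e12' : (p1 + s1) * (q2 - r2) - w * (q1 + r1) - r2 * (2 * s1 - 4 * t) +
      q2 * (2 * p1 - 4 * t) + 2 * (x1 * y2 - x2 * y1) = 0)
    (b1 : x1 * (p1 + 7 * t) - x2 * a + y1 * r1 - y2 * r2 = 0)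
    (b1' : x1 * a + x2 * (p1 + 7 * t) + y1 * r2 + y2 * r1 = 0)
    (b2 : x1 * q1 - x2 * q2 + y1 * (s1 + 7 * t) - y2 * b = 0)
    (b2' : x1 * q2 + x2 * q1 + y1 * b + y2 * (s1 + 7 * t) = 0) : t = 0 := by
  obtain rfl : s1 = t - p1 := by linarith
  obtain ⟨u, rfl⟩ : ∃ u, q1 = u - r1 := ⟨q1 + r1, by ring⟩
  obtain ⟨v, rfl⟩ : ∃ v, q2 = v + r2 := ⟨q2 - r2, by ring⟩
  have hn : (2 * p1 - t) ^ 2 + u ^ 2 + v ^ 2 = 15 * t ^ 2 - (x1 ^ 2 + x2 ^ 2 + y1 ^ 2 + y2 ^ 2) := by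
    linear_combination e11 + e22
  by_cases hb : x1 ^ 2 + x2 ^ 2 + y1 ^ 2 + y2 ^ 2 = 0
  · obtain rfl : x1 = 0 := by nlinarith [sq_nonneg x1, sq_nonneg x2, sq_nonneg y1, sq_nonneg y2]
    obtain rfl : x2 = 0 := by nlinarith [sq_nonneg x2, sq_nonneg y1, sq_nonneg y2]
    obtain rfl : y1 = 0 := by nlinarith [sq_nonneg y1, sq_nonneg y2]
    obtain rfl : y2 = 0 := by nlinarith [sq_nonneg y2]
    have : t ^ 3 = 0 := by
      linear_combination (4 * p1 * e11 + 4 * (t - p1) * e22 + 2 * (u * e12 + v * e12') + 2 * t * hn) / (-60)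
    simpa using this
  · have hq : (2 * p1 - t) * (x1 ^ 2 + x2 ^ 2 - (y1 ^ 2 + y2 ^ 2)) + u * (2 * (x1 * y1 + x2 * y2)) +
        v * (2 * (x1 * y2 - x2 * y1)) = -15 * t * (x1 ^ 2 + x2 ^ 2 + y1 ^ 2 + y2 ^ 2) := by
      linear_combination 2 * (x1 * b1 + x2 * b1' + y1 * b2 + y2 * b2')
    set N := x1 ^ 2 + x2 ^ 2 + y1 ^ 2 + y2 ^ 2 with hN
    set d := 2 * p1 - t with hd
    have hbb : (x1 ^ 2 + x2 ^ 2 - (y1 ^ 2 + y2 ^ 2)) ^ 2 + (2 * (x1 * y1 + x2 * y2)) ^ 2 +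
        (2 * (x1 * y2 - x2 * y1)) ^ 2 = N ^ 2 := by rw [hN]; ring
    have hb0 : 0 ≤ N := by positivity
    generalize x1 ^ 2 + x2 ^ 2 - (y1 ^ 2 + y2 ^ 2) = X at hq hbb
    generalize 2 * (x1 * y1 + x2 * y2) = Y at hq hbb
    generalize 2 * (x1 * y2 - x2 * y1) = Z at hq hbb
    have cs : (d * X + u * Y + v * Z) ^ 2 ≤ (d ^ 2 + u ^ 2 + v ^ 2) * (X ^ 2 + Y ^ 2 + Z ^ 2) := by
      have h : (d ^ 2 + u ^ 2 + v ^ 2) * (X ^ 2 + Y ^ 2 + Z ^ 2) - (d * X + u * Y + v * Z) ^ 2 =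
          (d * Y - u * X) ^ 2 + (d * Z - v * X) ^ 2 + (u * Z - v * Y) ^ 2 := by ring
      have : 0 ≤ (d * Y - u * X) ^ 2 + (d * Z - v * X) ^ 2 + (u * Z - v * Y) ^ 2 := by positivity
      linarith
    rw [hq, hn, hbb] at cs
    have hb2 : 0 < N ^ 2 := by positivity
    have h : (210 * t ^ 2 + N) * N ^ 2 ≤ 0 := by linear_combination cs
    have : 210 * t ^ 2 + N ≤ 0 := nonpos_of_mul_nonpos_left h hb2
    have : t ^ 2 = 0 := le_antisymm (by linarith [sq_nonneg t]) (sq_nonneg t)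
    simpa using this

theorem phi0_apply (x y z : Fin 7 → ℝ) :
    phi0 ![x, y, z] =
      (x 0 * (y 1 * z 6 - y 6 * z 1) - x 1 * (y 0 * z 6 - y 6 * z 0) +
          x 6 * (y 0 * z 1 - y 1 * z 0)) +
        (x 2 * (y 3 * z 6 - y 6 * z 3) - x 3 * (y 2 * z 6 - y 6 * z 2) +
          x 6 * (y 2 * z 3 - y 3 * z 2)) +
        (x 4 * (y 5 * z 6 - y 6 * z 5) - x 5 * (y 4 * z 6 - y 6 * z 4) +
          x 6 * (y 4 * z 5 - y 5 * z 4)) +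
        (x 0 * (y 2 * z 4 - y 4 * z 2) - x 2 * (y 0 * z 4 - y 4 * z 0) +
          x 4 * (y 0 * z 2 - y 2 * z 0)) -
        (x 0 * (y 3 * z 5 - y 5 * z 3) - x 3 * (y 0 * z 5 - y 5 * z 0) +
          x 5 * (y 0 * z 3 - y 3 * z 0)) -
        (x 1 * (y 2 * z 5 - y 5 * z 2) - x 2 * (y 1 * z 5 - y 5 * z 1) +
          x 5 * (y 1 * z 2 - y 2 * z 1)) -
        (x 1 * (y 3 * z 4 - y 4 * z 3) - x 3 * (y 1 * z 4 - y 4 * z 1) +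
          x 4 * (y 1 * z 3 - y 3 * z 1)) := by
  simp only [phi0, wedgeCov_three, pr, AlternatingMap.sub_apply, AlternatingMap.add_apply,
    LinearMap.proj_apply]

/-- The cross product on `ℝ⁷` determined by `phi0` and the Euclidean metric. -/
def g2Cross (x y : Fin 7 → ℝ) : Fin 7 → ℝ :=
  ![x 1 * y 6 - x 6 * y 1 + (x 2 * y 4 - x 4 * y 2) - (x 3 * y 5 - x 5 * y 3),
    x 6 * y 0 - x 0 * y 6 - (x 2 * y 5 - x 5 * y 2) - (x 3 * y 4 - x 4 * y 3),
    x 3 * y 6 - x 6 * y 3 + (x 4 * y 0 - x 0 * y 4) - (x 5 * y 1 - x 1 * y 5),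
    x 6 * y 2 - x 2 * y 6 - (x 5 * y 0 - x 0 * y 5) - (x 4 * y 1 - x 1 * y 4),
    x 5 * y 6 - x 6 * y 5 + (x 0 * y 2 - x 2 * y 0) - (x 1 * y 3 - x 3 * y 1),
    x 6 * y 4 - x 4 * y 6 - (x 0 * y 3 - x 3 * y 0) - (x 1 * y 2 - x 2 * y 1),
    x 0 * y 1 - x 1 * y 0 + (x 2 * y 3 - x 3 * y 2) + (x 4 * y 5 - x 5 * y 4)]

theorem phi0_eq (x y z : Fin 7 → ℝ) : phi0 ![x, y, z] = g2Cross x y ⬝ᵥ z := by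
  rw [phi0_apply]
  simp [g2Cross, dotProduct, Fin.sum_univ_seven]
  ring

theorem g2Cross_anti (x y : Fin 7 → ℝ) : g2Cross x y = -g2Cross y x := by
  ext i; fin_cases i <;> simp [g2Cross] <;> ring

theorem g2Cross_g2Cross (x y z : Fin 7 → ℝ) : g2Cross x (g2Cross y z) =
    -g2Cross y (g2Cross x z) - (2 * x ⬝ᵥ y) • z + (x ⬝ᵥ z) • y + (y ⬝ᵥ z) • x := by
  ext i
  simp only [Pi.add_apply, Pi.sub_apply, Pi.neg_apply, Pi.smul_apply, smul_eq_mul]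
  fin_cases i <;> simp [g2Cross, dotProduct, Fin.sum_univ_seven] <;> ring

theorem g2Cross_dot_left (x y : Fin 7 → ℝ) : g2Cross x y ⬝ᵥ x = 0 := by
  simp [g2Cross, dotProduct, Fin.sum_univ_seven]; ring

theorem g2Cross_dot_right (x y : Fin 7 → ℝ) : g2Cross x y ⬝ᵥ y = 0 := by
  simp [g2Cross, dotProduct, Fin.sum_univ_seven]; ring

theorem g2Cross_dot_g2Cross (x y : Fin 7 → ℝ) :
    g2Cross x y ⬝ᵥ g2Cross x y = (x ⬝ᵥ x) * (y ⬝ᵥ y) - (x ⬝ᵥ y) ^ 2 := by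
  simp [g2Cross, dotProduct, Fin.sum_univ_seven]; ring

theorem star0_eq (x y z w : Fin 7 → ℝ) : star0 ![x, y, z, w] =
   - (g2Cross x (g2Cross y z) ⬝ᵥ w) - (x ⬝ᵥ y) * (z ⬝ᵥ w) + (x ⬝ᵥ z) * (y ⬝ᵥ w) := by
  simp only [star0, wedgeCov_four, pr, AlternatingMap.sub_apply, AlternatingMap.add_apply,
    LinearMap.proj_apply]
  simp [g2Cross, dotProduct, Fin.sum_univ_seven]; ring

theorem g2Cross_dot_g2Cross_left (x y z : Fin 7 → ℝ) :
    g2Cross x y ⬝ᵥ g2Cross x z = (x ⬝ᵥ x) * (y ⬝ᵥ z) - (x ⬝ᵥ y) * (x ⬝ᵥ z) := by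
  simp [g2Cross, dotProduct, Fin.sum_univ_seven]; ring

theorem g2Cross_dot_cyclic (x y z : Fin 7 → ℝ) : g2Cross x y ⬝ᵥ z = g2Cross y z ⬝ᵥ x := by
  simp [g2Cross, dotProduct, Fin.sum_univ_seven]; ring

/-- The cross product as a bilinear map. -/
noncomputable def g2CrossLin : (Fin 7 → ℝ) →ₗ[ℝ] (Fin 7 → ℝ) →ₗ[ℝ] (Fin 7 → ℝ) :=
  LinearMap.mk₂ ℝ g2Cross
    (fun x x' y => by ext i; fin_cases i <;> simp [g2Cross] <;> ring)
    (fun c x y => by ext i; fin_cases i <;> simp [g2Cross] <;> ring)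
    (fun x y y' => by ext i; fin_cases i <;> simp [g2Cross] <;> ring)
    (fun c x y => by ext i; fin_cases i <;> simp [g2Cross] <;> ring)

theorem g2CrossLin_apply (x y : Fin 7 → ℝ) : g2CrossLin x y = g2Cross x y := rfl

theorem g2Cross_self (x : Fin 7 → ℝ) : g2Cross x x = 0 := by
  ext i; fin_cases i <;> simp [g2Cross] <;> ring

theorem g2Cross_neg_right (x y : Fin 7 → ℝ) : g2Cross x (-y) = -g2Cross x y :=
  map_neg (g2CrossLin x) y

theorem g2Cross_g2Cross_of_orthogonal {x y z : Fin 7 → ℝ} (hxy : x ⬝ᵥ y = 0) (hxz : x ⬝ᵥ z = 0)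
    (hyz : y ⬝ᵥ z = 0) : g2Cross x (g2Cross y z) = -g2Cross y (g2Cross x z) := by
  rw [g2Cross_g2Cross, hxy, hxz, hyz]; simp

theorem g2Cross_g2Cross_self {x y : Fin 7 → ℝ} (hx : x ⬝ᵥ x = 1) (hxy : x ⬝ᵥ y = 0) :
    g2Cross x (g2Cross x y) = -y := by
  have h := g2Cross_g2Cross x x y
  rw [hx, hxy] at h
  ext i
  have := congrFun h i
  simp at this ⊢
  linarith

theorem exists_adapted_frame {n a y : Fin 7 → ℝ} (hn : n ⬝ᵥ n = 1) (ha : a ⬝ᵥ a = 1)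
    (hy : y ⬝ᵥ y = 1) (hna : n ⬝ᵥ a = 0) (hny : n ⬝ᵥ y = 0) (hay : a ⬝ᵥ y = 0)
    (hey : g2Cross n a ⬝ᵥ y = 0) :
    ∃ A : (Fin 7 → ℝ) ≃ₗ[ℝ] (Fin 7 → ℝ), A (Pi.single 6 1) = n ∧ A (Pi.single 4 1) = a ∧
      A (Pi.single 5 1) = g2Cross n a ∧ (∀ x y, g2Cross (A x) (A y) = A (g2Cross x y)) ∧
      ∀ x y, A x ⬝ᵥ A y = x ⬝ᵥ y := by
  obtain ⟨e, he⟩ : ∃ e, g2Cross n a = e := ⟨_, rfl⟩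
  obtain ⟨b, hb⟩ : ∃ b, g2Cross n y = b := ⟨_, rfl⟩
  obtain ⟨c, hc⟩ : ∃ c, g2Cross a y = c := ⟨_, rfl⟩
  obtain ⟨d, hd⟩ : ∃ d, g2Cross n c = d := ⟨_, rfl⟩
  have sw (p q : Fin 7 → ℝ) (h : p ⬝ᵥ q = 0) : q ⬝ᵥ p = 0 := by rw [dotProduct_comm, h]
  rw [he] at hey
  have hnb : n ⬝ᵥ b = 0 := sw _ _ (by rw [← hb, g2Cross_dot_left])
  have hyb : y ⬝ᵥ b = 0 := sw _ _ (by rw [← hb, g2Cross_dot_right])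
  have hac : a ⬝ᵥ c = 0 := sw _ _ (by rw [← hc, g2Cross_dot_left])
  have hyc : y ⬝ᵥ c = 0 := sw _ _ (by rw [← hc, g2Cross_dot_right])
  have hnd : n ⬝ᵥ d = 0 := sw _ _ (by rw [← hd, g2Cross_dot_left])
  have hcd : c ⬝ᵥ d = 0 := sw _ _ (by rw [← hd, g2Cross_dot_right])
  have hne : n ⬝ᵥ e = 0 := sw _ _ (by rw [← he, g2Cross_dot_left])
  have hae : a ⬝ᵥ e = 0 := sw _ _ (by rw [← he, g2Cross_dot_right])
  have hye : y ⬝ᵥ e = 0 := sw _ _ hey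
  have hnc : n ⬝ᵥ c = 0 := sw _ _ (by rw [← hc, ← g2Cross_dot_cyclic n a y, he, hey])
  have hab : a ⬝ᵥ b = 0 := sw _ _ (by
    rw [← hb, g2Cross_dot_cyclic n y a, g2Cross_dot_cyclic y a n, g2Cross_anti a n, he, neg_dotProduct, hey,
      neg_zero])
  have hbc : b ⬝ᵥ c = 0 := by
    rw [← hb, ← hc, g2Cross_anti n y, g2Cross_anti a y, neg_dotProduct_neg, g2Cross_dot_g2Cross_left, hna,
      sw _ _ hny]; ring
  have hec : e ⬝ᵥ c = 0 := by
    rw [← he, ← hc, g2Cross_anti n a, neg_dotProduct, g2Cross_dot_g2Cross_left, hny, sw _ _ hna]; ring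
  have hyd : y ⬝ᵥ d = 0 := sw _ _ (by
    rw [← hd, g2Cross_dot_cyclic n c y, g2Cross_dot_cyclic c y n, g2Cross_anti y n, hb, neg_dotProduct, hbc,
      neg_zero])
  have had : a ⬝ᵥ d = 0 := sw _ _ (by
    rw [← hd, g2Cross_dot_cyclic n c a, g2Cross_dot_cyclic c a n, g2Cross_anti a n, he, neg_dotProduct, hec,
      neg_zero])
  have hbd : b ⬝ᵥ d = 0 := by
    rw [← hb, ← hd, g2Cross_dot_g2Cross_left, hyc, hny]; ring
  have hde : d ⬝ᵥ e = 0 := by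
    rw [← he, ← hd, g2Cross_dot_g2Cross_left, sw _ _ hac, hnc]; ring
  have hbe : b ⬝ᵥ e = 0 := by
    rw [← he, ← hb, g2Cross_dot_g2Cross_left, sw _ _ hay, hny]; ring
  have hbb : b ⬝ᵥ b = 1 := by rw [← hb, g2Cross_dot_g2Cross, hn, hy, hny]; norm_num
  have hcc : c ⬝ᵥ c = 1 := by rw [← hc, g2Cross_dot_g2Cross, ha, hy, hay]; norm_num
  have hdd : d ⬝ᵥ d = 1 := by rw [← hd, g2Cross_dot_g2Cross, hn, hcc, hnc]; norm_num
  have hee : e ⬝ᵥ e = 1 := by rw [← he, g2Cross_dot_g2Cross, hn, ha, hna]; norm_num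
  -- the multiplication table
  have c61 : g2Cross n b = -y := by rw [← hb, g2Cross_g2Cross_self hn hny]
  have c01 : g2Cross y b = n := by rw [← hb, g2Cross_anti n y, g2Cross_neg_right, g2Cross_g2Cross_self hy (sw _ _ hny), neg_neg]
  have c63 : g2Cross n d = -c := by rw [← hd, g2Cross_g2Cross_self hn hnc]
  have c23 : g2Cross c d = n := by rw [← hd, g2Cross_anti n c, g2Cross_neg_right, g2Cross_g2Cross_self hcc (sw _ _ hnc), neg_neg]
  have c65 : g2Cross n e = -a := by rw [← he, g2Cross_g2Cross_self hn hna]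
  have c45 : g2Cross a e = n := by rw [← he, g2Cross_anti n a, g2Cross_neg_right, g2Cross_g2Cross_self ha (sw _ _ hna), neg_neg]
  have c02 : g2Cross y c = a := by rw [← hc, g2Cross_anti a y, g2Cross_neg_right, g2Cross_g2Cross_self hy (sw _ _ hay), neg_neg]
  have c42 : g2Cross a c = -y := by rw [← hc, g2Cross_g2Cross_self ha hay]
  have c03 : g2Cross y d = -e := by
    rw [← hd, g2Cross_g2Cross_of_orthogonal (sw _ _ hny) hyc hnc, c02, he]
  have c05 : g2Cross y e = d := by
    rw [← he, g2Cross_g2Cross_of_orthogonal (sw _ _ hny) (sw _ _ hay) hna, g2Cross_anti y a, hc, g2Cross_neg_right,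
      neg_neg, hd]
  have c25 : g2Cross c e = -b := by
    rw [← he, g2Cross_g2Cross_of_orthogonal (sw _ _ hnc) (sw _ _ hac) hna, g2Cross_anti c a, c42, neg_neg, hb]
  have c35 : g2Cross d e = -y := by
    rw [g2Cross_anti d e, ← hd, g2Cross_g2Cross_of_orthogonal (sw _ _ hne) hec hnc, g2Cross_anti e c, c25, neg_neg, neg_neg, c61]
  have c12 : g2Cross b c = -e := by
    rw [← hc, g2Cross_g2Cross_of_orthogonal (sw _ _ hab) (sw _ _ hyb) hay, g2Cross_anti b y, c01, g2Cross_neg_right,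
      neg_neg, g2Cross_anti a n, he]
  have c15 : g2Cross b e = c := by
    rw [g2Cross_anti b e, ← hb, g2Cross_g2Cross_of_orthogonal (sw _ _ hne) hey hny, g2Cross_anti e y, c05,
      g2Cross_neg_right, c63]; simp
  have c13 : g2Cross b d = -a := by
    rw [← hd, g2Cross_g2Cross_of_orthogonal (sw _ _ hnb) hbc hnc, c12, g2Cross_neg_right, c65]; simp
  have c43 : g2Cross a d = b := by
    rw [← hd, g2Cross_g2Cross_of_orthogonal (sw _ _ hna) hac hnc, c42, g2Cross_neg_right, hb, neg_neg]
  have c41 : g2Cross a b = -d := by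
    rw [← hb, g2Cross_g2Cross_of_orthogonal (sw _ _ hna) hay hny, hc, hd]
  let v : Fin 7 → Fin 7 → ℝ := ![y, b, c, d, a, e, n]
  let A₀ : (Fin 7 → ℝ) →ₗ[ℝ] (Fin 7 → ℝ) := Fintype.linearCombination ℝ v
  have hA (x : Fin 7 → ℝ) : A₀ x = x 0 • y + x 1 • b + x 2 • c + x 3 • d + x 4 • a + x 5 • e +
      x 6 • n := by
    simp only [A₀, Fintype.linearCombination_apply, Fin.sum_univ_seven]; rfl
  have hdot (x z : Fin 7 → ℝ) : A₀ x ⬝ᵥ A₀ z = x ⬝ᵥ z := by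
    rw [hA, hA]
    simp only [add_dotProduct, dotProduct_add, smul_dotProduct, dotProduct_smul, smul_eq_mul,
      hn, ha, hy, hbb, hcc, hdd, hee, hna, hny, hay, hey, hnb, hyb, hac, hyc, hnd, hcd, hne, hae,
      hye, hnc, hab, hbc, hec, hyd, had, hbd, hde, hbe, sw _ _ hna, sw _ _ hny, sw _ _ hay,
      sw _ _ hnb, sw _ _ hyb, sw _ _ hac, sw _ _ hyc, sw _ _ hnd, sw _ _ hcd, sw _ _ hne,
      sw _ _ hae, sw _ _ hnc, sw _ _ hab, sw _ _ hbc, sw _ _ hec, sw _ _ hyd,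
      sw _ _ had, sw _ _ hbd, sw _ _ hde, sw _ _ hbe]
    simp only [dotProduct, Fin.sum_univ_seven]
    ring
  have hcr (x z : Fin 7 → ℝ) : g2Cross (A₀ x) (A₀ z) = A₀ (g2Cross x z) := by
    rw [hA, hA, hA]
    simp only [← g2CrossLin_apply (_ + _), map_add, map_smul, LinearMap.add_apply, LinearMap.smul_apply]
    simp only [g2CrossLin_apply, g2Cross_self, hb, hc, hd, he, c61, c01, c63, c23, c65, c45, c02, c42, c03,
      c05, c25, c35, c12, c15, c13, c43, c41, g2Cross_anti b n, g2Cross_anti b y, g2Cross_anti d n, g2Cross_anti d c,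
      g2Cross_anti e n, g2Cross_anti e a, g2Cross_anti c y, g2Cross_anti c a, g2Cross_anti d y, g2Cross_anti e y, g2Cross_anti e c,
      g2Cross_anti e d, g2Cross_anti c b, g2Cross_anti e b, g2Cross_anti d b, g2Cross_anti d a, g2Cross_anti b a, g2Cross_anti y n,
      g2Cross_anti y a, g2Cross_anti c n, g2Cross_anti a n]
    simp only [g2Cross, Matrix.cons_val]
    module
  have hinj : Function.Injective A₀ := by
    rw [injective_iff_map_eq_zero]
    intro x hx
    have h := hdot x x
    rw [hx, zero_dotProduct] at h
    exact dotProduct_self_eq_zero.mp h.symm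
  refine ⟨LinearEquiv.ofInjectiveEndo A₀ hinj, ?_, ?_, ?_, hcr, hdot⟩
  · change A₀ _ = _; rw [hA]; simp
  · change A₀ _ = _; rw [hA]; simp
  · change A₀ _ = _; rw [hA, he]; simp

set_option maxHeartbeats 4000000 in
theorem structure_constants_contradiction (C : Fin 7 → Fin 7 → Fin 7 → ℝ) (T : Fin 7 → Fin 7 → ℝ) (μ : ℝ)
    (hμ : μ ≠ 0) (hC : ∀ i j, C i j = -C j i) (hT : ∀ i j, T i j = -T j i)
    (h1 : ∀ i j m, i < 4 → j < 4 → m < 4 ∨ m = 6 → C i j m = 0)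
    (h2 : ∀ i j, i < 6 → j = 4 ∨ j = 5 → C i j = 0)
    (h3 : ∀ i, i < 6 → C i 6 6 = 0)
    (h4 : ∀ i m, i = 4 ∨ i = 5 → m < 4 → C i 6 m = 0)
    (hJ : ∀ i j k n, ∑ m, C i j m * C m k n = ∑ m, C i k m * C m j n + ∑ m, C j k m * C i m n)
    (hp : ∀ x y z w : Fin 7,
      -phi0 ![C x y, Pi.single z 1, Pi.single w 1] + phi0 ![C x z, Pi.single y 1, Pi.single w 1] -
        phi0 ![C x w, Pi.single y 1, Pi.single z 1] - phi0 ![C y z, Pi.single x 1, Pi.single w 1] +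
        phi0 ![C y w, Pi.single x 1, Pi.single z 1] - phi0 ![C z w, Pi.single x 1, Pi.single y 1]
        = 0)
    (hs : ∀ a b c d e : Fin 7,
      -star0 ![C a b, Pi.single c 1, Pi.single d 1, Pi.single e 1] +
        star0 ![C a c, Pi.single b 1, Pi.single d 1, Pi.single e 1] -
        star0 ![C a d, Pi.single b 1, Pi.single c 1, Pi.single e 1] +
        star0 ![C a e, Pi.single b 1, Pi.single c 1, Pi.single d 1] -
        star0 ![C b c, Pi.single a 1, Pi.single d 1, Pi.single e 1] +
        star0 ![C b d, Pi.single a 1, Pi.single c 1, Pi.single e 1] -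
        star0 ![C b e, Pi.single a 1, Pi.single c 1, Pi.single d 1] -
        star0 ![C c d, Pi.single a 1, Pi.single b 1, Pi.single e 1] +
        star0 ![C c e, Pi.single a 1, Pi.single b 1, Pi.single d 1] -
        star0 ![C d e, Pi.single a 1, Pi.single b 1, Pi.single c 1] =
      T a b * phi0 ![Pi.single c 1, Pi.single d 1, Pi.single e 1] -
        T a c * phi0 ![Pi.single b 1, Pi.single d 1, Pi.single e 1] +
        T a d * phi0 ![Pi.single b 1, Pi.single c 1, Pi.single e 1] -
        T a e * phi0 ![Pi.single b 1, Pi.single c 1, Pi.single d 1] +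
        T b c * phi0 ![Pi.single a 1, Pi.single d 1, Pi.single e 1] -
        T b d * phi0 ![Pi.single a 1, Pi.single c 1, Pi.single e 1] +
        T b e * phi0 ![Pi.single a 1, Pi.single c 1, Pi.single d 1] +
        T c d * phi0 ![Pi.single a 1, Pi.single b 1, Pi.single e 1] -
        T c e * phi0 ![Pi.single a 1, Pi.single b 1, Pi.single d 1] +
        T d e * phi0 ![Pi.single a 1, Pi.single b 1, Pi.single c 1])
    (ht : ∀ x y z : Fin 7, -∑ m, C x y m * T m z + ∑ m, C x z m * T m y - ∑ m, C y z m * T m x =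
      μ * phi0 ![Pi.single x 1, Pi.single y 1, Pi.single z 1]) : False := by
  have T0 (i) : T i i = 0 := by linarith [hT i i]
  have C0 (i) : C i i = 0 := by have := hC i i; funext m; have := congrFun this m; simp only [Pi.neg_apply, Pi.zero_apply] at this ⊢; linarith
  have hTle (i j) (h : j < i) : T i j = -T j i := hT i j
  have hCle (i j) (h : j < i) : C i j = -C j i := hC i j
  simp only [phi0_eq] at hp ht
  simp only [star0_eq, phi0_eq] at hs
  simp only [Fin.sum_univ_seven] at ht hJ
  have ht4 (i j : Fin 7) (hi : i < 4) (hj : j < 4) :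
      C i j 5 * T 4 5 = μ * (g2Cross (Pi.single i 1) (Pi.single j 1) ⬝ᵥ Pi.single 4 1) := by
    rw [← ht i j 4, h2 i 4 (hi.trans (by decide)) (.inl rfl), h2 j 4 (hj.trans (by decide)) (.inl rfl),
      h1 i j 0 hi hj (by decide), h1 i j 1 hi hj (by decide), h1 i j 2 hi hj (by decide),
      h1 i j 3 hi hj (by decide), h1 i j 6 hi hj (by decide), hT 5 4, T0]
    simp
  have ht5 (i j : Fin 7) (hi : i < 4) (hj : j < 4) :
      -C i j 4 * T 4 5 = μ * (g2Cross (Pi.single i 1) (Pi.single j 1) ⬝ᵥ Pi.single 5 1) := by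
    rw [← ht i j 5, h2 i 5 (hi.trans (by decide)) (.inr rfl), h2 j 5 (hj.trans (by decide)) (.inr rfl),
      h1 i j 0 hi hj (by decide), h1 i j 1 hi hj (by decide), h1 i j 2 hi hj (by decide),
      h1 i j 3 hi hj (by decide), h1 i j 6 hi hj (by decide), T0]
    simp
  obtain ⟨t, hk⟩ : ∃ t, C 0 2 5 = -2 * t := ⟨-C 0 2 5 / 2, by ring⟩
  have hμt : μ = -2 * t * T 4 5 := by
    rw [← hk, ht4 0 2 (by decide) (by decide)]; simp [g2Cross, dotProduct, Fin.sum_univ_seven]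
  have hT0 : T 4 5 ≠ 0 := by rintro h; exact hμ (by rw [hμt, h, mul_zero])
  have ht0 : t ≠ 0 := by rintro rfl; simp [hμt] at hμ
  have c014 : C 0 1 4 = 0 := by
    have h := ht5 0 1 (by decide) (by decide)
    simpa [g2Cross, dotProduct, Fin.sum_univ_seven, hT0] using h
  have c015 : C 0 1 5 = 0 := by
    have h := ht4 0 1 (by decide) (by decide)
    simpa [g2Cross, dotProduct, Fin.sum_univ_seven, hT0] using h
  have c024 : C 0 2 4 = 0 := by
    have h := ht5 0 2 (by decide) (by decide)
    simpa [g2Cross, dotProduct, Fin.sum_univ_seven, hT0] using h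
  have c034 : C 0 3 4 = -2 * t := by
    have h := ht5 0 3 (by decide) (by decide)
    refine mul_right_cancel₀ hT0 ?_
    simp [g2Cross, dotProduct, Fin.sum_univ_seven] at h
    linarith
  have c035 : C 0 3 5 = 0 := by
    have h := ht4 0 3 (by decide) (by decide)
    simpa [g2Cross, dotProduct, Fin.sum_univ_seven, hT0] using h
  have c124 : C 1 2 4 = -2 * t := by
    have h := ht5 1 2 (by decide) (by decide)
    refine mul_right_cancel₀ hT0 ?_
    simp [g2Cross, dotProduct, Fin.sum_univ_seven] at h
    linarith
  have c125 : C 1 2 5 = 0 := by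
    have h := ht4 1 2 (by decide) (by decide)
    simpa [g2Cross, dotProduct, Fin.sum_univ_seven, hT0] using h
  have c134 : C 1 3 4 = 0 := by
    have h := ht5 1 3 (by decide) (by decide)
    simpa [g2Cross, dotProduct, Fin.sum_univ_seven, hT0] using h
  have c135 : C 1 3 5 = 2 * t := by
    have h := ht4 1 3 (by decide) (by decide)
    refine mul_right_cancel₀ hT0 ?_
    simp [g2Cross, dotProduct, Fin.sum_univ_seven] at h
    linarith
  have c234 : C 2 3 4 = 0 := by
    have h := ht5 2 3 (by decide) (by decide)
    simpa [g2Cross, dotProduct, Fin.sum_univ_seven, hT0] using h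
  have c235 : C 2 3 5 = 0 := by
    have h := ht4 2 3 (by decide) (by decide)
    simpa [g2Cross, dotProduct, Fin.sum_univ_seven, hT0] using h
  have j025 := hJ 0 2 6 5
  have p0126 := hp 0 1 2 6
  have p0136 := hp 0 1 3 6
  have p0146 := hp 0 1 4 6
  have p0156 := hp 0 1 5 6
  have p0236 := hp 0 2 3 6
  have p0246 := hp 0 2 4 6
  have p0256 := hp 0 2 5 6
  have p0346 := hp 0 3 4 6
  have p0356 := hp 0 3 5 6
  have p1236 := hp 1 2 3 6
  have p1246 := hp 1 2 4 6
  have p1256 := hp 1 2 5 6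
  have p1346 := hp 1 3 4 6
  have p1356 := hp 1 3 5 6
  have p2346 := hp 2 3 4 6
  have p2356 := hp 2 3 5 6
  have s01234 := hs 0 1 2 3 4
  have s01235 := hs 0 1 2 3 5
  have s01236 := hs 0 1 2 3 6
  have s01245 := hs 0 1 2 4 5
  have s01246 := hs 0 1 2 4 6
  have s01256 := hs 0 1 2 5 6
  have s01345 := hs 0 1 3 4 5
  have s01346 := hs 0 1 3 4 6
  have s01356 := hs 0 1 3 5 6
  have s01456 := hs 0 1 4 5 6
  have s02345 := hs 0 2 3 4 5
  have s02346 := hs 0 2 3 4 6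
  have s02356 := hs 0 2 3 5 6
  have s02456 := hs 0 2 4 5 6
  have s03456 := hs 0 3 4 5 6
  have s12345 := hs 1 2 3 4 5
  have s12346 := hs 1 2 3 4 6
  have s12356 := hs 1 2 3 5 6
  have s12456 := hs 1 2 4 5 6
  have s13456 := hs 1 3 4 5 6
  have s23456 := hs 2 3 4 5 6
  simp [h1, h2, h3, h4, T0, C0, hTle, hCle, g2Cross, dotProduct, Fin.sum_univ_seven, Pi.single_apply, hk, c014, c015, c024, c034, c035, c124, c125, c134, c135, c234, c235]
    at j025 p0126 p0136 p0146 p0156 p0236 p0246 p0256 p0346 p0356 p1236 p1246 p1256 p1346 p1356 p2346 p2356 s01234 s01235 s01236 s01245 s01246 s01256 s01345 s01346 s01356 s01456 s02345 s02346 s02356 s02456 s03456 s12345 s12346 s12356 s12456 s13456 s23456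
  have j025 : - C 5 6 5 + C 0 6 0 + C 2 6 2 = 0 := by
    refine mul_left_cancel₀ ht0 ?_
    linear_combination j025 / 2
  have hF10 : C 0 6 1 = - C 1 6 0 := by linear_combination 1/2 * p1356 + 1/2 * p0256 - 1/2 * p1246 + 1/2 * p0346
  have hF11 : C 1 6 1 = C 0 6 0 := by linear_combination 1/2 * p1346 + 1/2 * p0246 + 1/2 * p1256 - 1/2 * p0356
  have hF12 : C 2 6 1 = - C 3 6 0 := by linear_combination p2346
  have hF13 : C 3 6 1 = C 2 6 0 := by linear_combination - p2356
  have hF22 : C 2 6 2 = - C 0 6 0 - t := by linear_combination 1/2 * j025 + 1/4 * p1256 - 1/4 * p1346 - 1/4 * p0246 + 1/4 * p0356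
  have hF30 : C 0 6 3 = - C 1 6 2 := by linear_combination - p0146
  have hF31 : C 1 6 3 = C 0 6 2 := by linear_combination p0156
  have hF32 : C 2 6 3 = - C 3 6 2 := by linear_combination 1/2 * p1246 - 1/2 * p0346 + 1/2 * p1356 + 1/2 * p0256
  have hF33 : C 3 6 3 = - C 0 6 0 - t := by linear_combination - 1/4 * p1256 + 3/4 * p0356 + 1/4 * p1346 + 1/4 * p0246 + 1/2 * j025
  have hF44 : C 4 6 4 = - t := by linear_combination - 3/4 * p0246 - 1/2 * j025 - 1/4 * p1256 + 1/4 * p1346 - 1/4 * p0356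
  have hF45 : C 5 6 4 = - C 1 6 0 - C 3 6 2 := by linear_combination p1356
  have hF50 : C 0 6 5 = - C 1 6 4 := by linear_combination p0126
  have hF51 : C 1 6 5 = C 0 6 4 := by linear_combination - p0136
  have hF52 : C 2 6 5 = - C 3 6 4 := by linear_combination - p0236
  have hF53 : C 3 6 5 = C 2 6 4 := by linear_combination p1236
  have hF54 : C 4 6 5 = C 3 6 2 + C 1 6 0 := by linear_combination 1/2 * p0346 - 1/2 * p1356 - 1/2 * p0256 + 1/2 * p1246
  have hF55 : C 5 6 5 = - t := by linear_combination 1/4 * p1256 - 1/4 * p1346 - 1/4 * p0246 + 1/4 * p0356 - 1/2 * j025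
  have hT01 : T 0 1 = 4 * t + 2 * C 0 6 0 := by linear_combination 1/2 * s23456 + 1/2 * p0246 - 1/2 * p0356 - 1/2 * s01236 + 1/2 * p1346 - 1/2 * s01456 + 1/2 * p1256
  have hT02 : T 0 2 = C 1 6 2 - C 3 6 0 := by linear_combination - 1/2 * s13456 - 1/2 * s01234 - 1/2 * s02456 + 1/2 * p0146 + 1/2 * p2346
  have hT03 : T 0 3 = C 2 6 0 + C 0 6 2 := by linear_combination 1/2 * s12456 + 1/2 * p0156 + 1/2 * s01235 - 1/2 * s03456 - 1/2 * p2356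
  have hT04 : T 0 4 = C 1 6 4 := by linear_combination - 1/2 * s12356 + 1/2 * s01245 - 1/2 * s02346 - 1/2 * p0126
  have hT05 : T 0 5 = C 0 6 4 := by linear_combination 1/2 * s12346 - 1/2 * p0136 - 1/2 * s01345 - 1/2 * s02356
  have hT06 : T 0 6 = 0 := by linear_combination - 1/2 * s12345 - 1/2 * s01256 - 1/2 * s01346 - 1/2 * p1236
  have hT12 : T 1 2 = - C 2 6 0 - C 0 6 2 := by linear_combination 1/2 * s01235 - 1/2 * s12456 - 1/2 * p0156 + 1/2 * s03456 + 1/2 * p2356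
  have hT13 : T 1 3 = C 1 6 2 - C 3 6 0 := by linear_combination 1/2 * s01234 - 1/2 * s13456 - 1/2 * s02456 + 1/2 * p0146 + 1/2 * p2346
  have hT14 : T 1 4 = - C 0 6 4 := by linear_combination - 1/2 * s01345 - 1/2 * s12346 + 1/2 * p0136 + 1/2 * s02356
  have hT15 : T 1 5 = C 1 6 4 := by linear_combination - 1/2 * s01245 - 1/2 * s12356 - 1/2 * s02346 - 1/2 * p0126
  have hT16 : T 1 6 = 0 := by linear_combination 1/2 * s02345 - 1/2 * s01246 + 1/2 * p0236 + 1/2 * s01356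
  have hT23 : T 2 3 = 2 * t - 2 * C 0 6 0 := by linear_combination - 1/2 * s01236 - 1/2 * s23456 + p0356 + 1/2 * s01456 + j025
  have hT24 : T 2 4 = C 3 6 4 := by linear_combination - 1/2 * s01246 + 1/2 * p0236 - 1/2 * s02345 - 1/2 * s01356
  have hT25 : T 2 5 = C 2 6 4 := by linear_combination - 1/2 * s01256 + 1/2 * s12345 + 1/2 * s01346 + 1/2 * p1236
  have hT26 : T 2 6 = 0 := by linear_combination 1/2 * s02356 + 1/2 * s12346 - 1/2 * p0136 - 1/2 * s01345
  have hT34 : T 3 4 = - C 2 6 4 := by linear_combination - 1/2 * s01346 - 1/2 * p1236 + 1/2 * s12345 + 1/2 * s01256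
  have hT35 : T 3 5 = C 3 6 4 := by linear_combination - 1/2 * s01356 + 1/2 * s02345 - 1/2 * s01246 + 1/2 * p0236
  have hT36 : T 3 6 = 0 := by linear_combination 1/2 * s02346 + 1/2 * p0126 - 1/2 * s12356 + 1/2 * s01245
  have hT45 : T 4 5 = - 6 * t := by linear_combination - 1/2 * s01456 - p0246 - 1/2 * s23456 + 1/2 * s01236 - j025
  have hT46 : T 4 6 = 0 := by linear_combination - 1/2 * s03456 - 1/2 * p2356 - 1/2 * s12456 - 1/2 * p0156 - 1/2 * s01235
  have hT56 : T 5 6 = 0 := by linear_combination - 1/2 * s02456 + 1/2 * p0146 + 1/2 * p2346 + 1/2 * s13456 + 1/2 * s01234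
  clear j025 p0126 p0136 p0146 p0156 p0236 p0246 p0256 p0346 p0356 p1236 p1246 p1256 p1346 p1356 p2346 p2356 s01234 s01235 s01236 s01245 s01246 s01256 s01345 s01346 s01356 s01456 s02345 s02346 s02356 s02456 s03456 s12345 s12346 s12356 s12456 s13456 s23456
  have hμ12 : μ = 12 * t ^ 2 := by rw [hμt, hT45]; ring
  have q01 := ht 0 1 6
  have q23 := ht 2 3 6
  have q02 := ht 0 2 6
  have q03 := ht 0 3 6
  have q04 := ht 0 4 6
  have q05 := ht 0 5 6
  have q24 := ht 2 4 6
  have q25 := ht 2 5 6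
  simp [h1, h2, h3, h4, T0, C0, hTle, hCle, g2Cross, dotProduct, Fin.sum_univ_seven, Pi.single_apply, hk, c014, c015, c024, c034, c035, c124, c125, c134, c135, c234, c235, hμ12, hF10, hF11, hF12, hF13, hF22, hF30, hF31, hF32, hF33, hF44, hF45, hF50, hF51, hF52, hF53, hF54, hF55, hT01, hT02, hT03, hT04, hT05, hT06, hT12, hT13, hT14, hT15, hT16, hT23, hT24, hT25, hT26, hT34, hT35, hT36, hT45, hT46, hT56] at q01 q23 q02 q03 q04 q05 q24 q25
  refine ht0 (eq_zero_of_quadratic_system (-C 0 6 0) (-C 2 6 0) (C 3 6 0) (-C 0 6 2) (C 1 6 2) (C 0 6 0 + t) (-C 0 6 4)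
    (C 1 6 4) (-C 2 6 4) (C 3 6 4) t (C 1 6 0 - C 3 6 2) (2 * C 1 6 0 + C 3 6 2)
    (2 * C 3 6 2 + C 1 6 0) (by ring) ?_ ?_ ?_ ?_ ?_ ?_ ?_ ?_)
  · linear_combination q01 / 2
  · linear_combination q23 / 2
  · linear_combination q03
  · linear_combination q02
  · linear_combination q05
  · linear_combination -q04
  · linear_combination q25
  · linear_combination -q24

theorem exists_unit_smul {v : Fin 7 → ℝ} (hv : v ≠ 0) :
    ∃ (r : ℝ) (n : Fin 7 → ℝ), r ≠ 0 ∧ n ⬝ᵥ n = 1 ∧ v = r • n := by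
  have h : 0 < v ⬝ᵥ v :=
    lt_of_le_of_ne (Finset.sum_nonneg fun i _ => mul_self_nonneg _) fun h =>
      hv (dotProduct_self_eq_zero.mp h.symm)
  have hr : √(v ⬝ᵥ v) ≠ 0 := (Real.sqrt_pos.mpr h).ne'
  refine ⟨√(v ⬝ᵥ v), (√(v ⬝ᵥ v))⁻¹ • v, hr, ?_, ?_⟩
  · rw [smul_dotProduct, dotProduct_smul, smul_eq_mul, smul_eq_mul]
    field_simp
    rw [Real.sq_sqrt h.le]
  · rw [smul_smul, mul_inv_cancel₀ hr, one_smul]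

theorem exists_unit_orthogonal (a b c : Fin 7 → ℝ) :
    ∃ y : Fin 7 → ℝ, y ⬝ᵥ y = 1 ∧ a ⬝ᵥ y = 0 ∧ b ⬝ᵥ y = 0 ∧ c ⬝ᵥ y = 0 := by
  let f : (Fin 7 → ℝ) →ₗ[ℝ] (Fin 3 → ℝ) := Matrix.mulVecLin (Matrix.of ![a, b, c])
  have h : LinearMap.ker f ≠ ⊥ := LinearMap.ker_ne_bot_of_finrank_lt (by simp)
  obtain ⟨v, hv, hv0⟩ := Submodule.exists_mem_ne_zero_of_ne_bot h
  have hv' : ∀ i, f v i = 0 := fun i => congrFun hv i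
  obtain ⟨r, y, hr, hy, rfl⟩ := exists_unit_smul hv0
  have key (i : Fin 3) (w : Fin 7 → ℝ) (hw : w = ![a, b, c] i) : w ⬝ᵥ y = 0 := by
    have : w ⬝ᵥ (r • y) = 0 := by rw [hw]; exact hv' i
    rw [dotProduct_smul, smul_eq_mul] at this
    exact (mul_eq_zero.mp this).resolve_left hr
  exact ⟨y, hy, key 0 _ rfl, key 1 _ rfl, key 2 _ rfl⟩

theorem g2Cross_smul_left (r : ℝ) (x y : Fin 7 → ℝ) : g2Cross (r • x) y = r • g2Cross x y := by
  rw [← g2CrossLin_apply, map_smul]; rfl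

theorem g2Cross_smul_right (r : ℝ) (x y : Fin 7 → ℝ) : g2Cross x (r • y) = r • g2Cross x y :=
  map_smul (g2CrossLin x) r y

/-- If two independent vectors orthogonal to `n` have cross product orthogonal to `nᗮ`, then they
span a plane stable under `n × ·`. -/
theorem exists_plane_frame {n z₁ z₂ : Fin 7 → ℝ} (hn : n ⬝ᵥ n = 1) (h₁ : n ⬝ᵥ z₁ = 0)
    (hind : ∀ a b : ℝ, a • z₁ + b • z₂ = 0 → a = 0 ∧ b = 0)
    (h : ∀ v, n ⬝ᵥ v = 0 → g2Cross z₁ z₂ ⬝ᵥ v = 0) :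
    ∃ (a : Fin 7 → ℝ) (r β γ : ℝ), a ⬝ᵥ a = 1 ∧ r ≠ 0 ∧ γ ≠ 0 ∧ z₁ = r • a ∧
      z₂ = β • a + γ • g2Cross n a := by
  have hz : z₁ ≠ 0 := by
    rintro rfl
    exact one_ne_zero (hind 1 0 (by simp)).1
  obtain ⟨r, a, hr, ha, rfl⟩ := exists_unit_smul hz
  obtain ⟨s, hs⟩ : ∃ s : ℝ, g2Cross (r • a) z₂ = s • n := by
    refine ⟨n ⬝ᵥ g2Cross (r • a) z₂, ?_⟩
    rw [← sub_eq_zero, ← dotProduct_self_eq_zero]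
    have h₃ : n ⬝ᵥ (g2Cross (r • a) z₂ - (n ⬝ᵥ g2Cross (r • a) z₂) • n) = 0 := by
      rw [dotProduct_sub, dotProduct_smul, hn]; simp
    rw [sub_dotProduct, h _ h₃, smul_dotProduct, h₃]; simp
  rw [g2Cross_smul_left] at hs
  have hna : a ⬝ᵥ n = 0 := by
    rw [dotProduct_comm]
    simpa [dotProduct_smul, hr] using h₁
  have h₂ : r • z₂ = (r * (a ⬝ᵥ z₂)) • a + s • g2Cross n a := by
    have := g2Cross_g2Cross a a z₂
    have hsa : r • g2Cross a (g2Cross a z₂) = -(s • g2Cross n a) := by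
      rw [← g2Cross_smul_right, hs, g2Cross_smul_right, g2Cross_anti a n, smul_neg]
    rw [ha] at this
    have h₃ : g2Cross a (g2Cross a z₂) = -z₂ + (a ⬝ᵥ z₂) • a := by
      ext i
      have := congrFun this i
      simp at this ⊢
      linarith
    rw [h₃] at hsa
    rw [← sub_eq_zero] at hsa ⊢
    rw [← neg_eq_zero, ← hsa]
    module
  have h₄ : z₂ = (a ⬝ᵥ z₂) • a + (s / r) • g2Cross n a := by
    rw [← smul_right_inj hr, h₂, smul_add, smul_smul, smul_smul, mul_div_cancel₀ _ hr]
  refine ⟨a, r, a ⬝ᵥ z₂, s / r, ha, hr, ?_, rfl, h₄⟩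
  intro h₀
  rw [h₀, zero_smul, add_zero] at h₄
  exact hr (neg_eq_zero.mp (hind (a ⬝ᵥ z₂) (-r) (by
    rw [smul_smul]; nth_rw 2 [h₄]; module)).2)

theorem exists_adapted_coordinates {V : Type*} [AddCommGroup V] [Module ℝ V] (W : Submodule ℝ V)
    (hW : ∃ e ∉ W, ∀ x : V, ∃ y ∈ W, ∃ t : ℝ, x = y + t • e) (u : V ≃ₗ[ℝ] (Fin 7 → ℝ)) {z₁ z₂ : V}
    (h₁ : z₁ ∈ W) (hind : ∀ a b : ℝ, a • z₁ + b • z₂ = 0 → a = 0 ∧ b = 0)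
    (h : ∀ x ∈ W, phi0 ![u z₁, u z₂, u x] = 0) :
    ∃ u' : V ≃ₗ[ℝ] (Fin 7 → ℝ), (∀ x y z, phi0 ![u x, u y, u z] = phi0 ![u' x, u' y, u' z]) ∧
      (∀ x y z w, star0 ![u x, u y, u z, u w] = star0 ![u' x, u' y, u' z, u' w]) ∧
      (∀ x, x ∈ W ↔ u' x 6 = 0) ∧ ∃ r β γ : ℝ, r ≠ 0 ∧ γ ≠ 0 ∧ u' z₁ = r • Pi.single 4 1 ∧
        u' z₂ = β • Pi.single 4 1 + γ • Pi.single 5 1 := by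
  obtain ⟨e, he, hcov⟩ := hW
  obtain ⟨l, hl, hlW⟩ := Submodule.exists_le_ker_of_notMem he
  have hmem (x : V) : x ∈ W ↔ l x = 0 := by
    refine ⟨fun hx => hlW hx, fun hx => ?_⟩
    obtain ⟨y, hy, t, rfl⟩ := hcov x
    have hly : l y = 0 := hlW hy
    have : t = 0 := by simpa [hly, hl] using hx
    simpa [this] using hy
  obtain ⟨N, hN⟩ : ∃ N : Fin 7 → ℝ, ∀ x, l x = N ⬝ᵥ u x := by
    refine ⟨fun i => l (u.symm (Pi.single i 1)), fun x => ?_⟩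
    have := map_eq_sum_single (l.comp u.symm.toLinearMap) (u x)
    simp only [LinearMap.comp_apply, LinearEquiv.coe_coe, LinearEquiv.symm_apply_apply] at this
    rw [this]
    simp only [dotProduct, smul_eq_mul, mul_comm]
  have hN0 : N ≠ 0 := by
    rintro rfl
    exact hl (by simp [hN])
  obtain ⟨k, n, hk, hn, rfl⟩ := exists_unit_smul hN0
  have hmem' (x : V) : x ∈ W ↔ n ⬝ᵥ u x = 0 := by
    rw [hmem, hN, smul_dotProduct, smul_eq_mul, mul_eq_zero, or_iff_right hk]
  obtain ⟨a, r, β, γ, ha, hr, hγ, hz₁, hz₂⟩ := exists_plane_frame hn ((hmem' z₁).mp h₁)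
    (z₂ := u z₂) (fun a b hab => hind a b (u.injective (by simpa using hab))) (fun v hv => by
      rw [← phi0_eq, ← u.apply_symm_apply v]
      exact h _ ((hmem' _).mpr (by simpa using hv)))
  have hna : n ⬝ᵥ a = 0 := by
    have := (hmem' z₁).mp h₁
    rw [hz₁] at this
    simpa [dotProduct_smul, hr] using this
  obtain ⟨y, hy, hny, hay, hey⟩ := exists_unit_orthogonal n a (g2Cross n a)
  obtain ⟨A, hA6, hA4, hA5, hAcr, hAdot⟩ := exists_adapted_frame hn ha hy hna hny hay hey
  have hAu (x : V) : u x = A ((u.trans A.symm) x) := by simp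
  refine ⟨u.trans A.symm, fun x y z => ?_, fun x y z w => ?_, fun x => ?_, r, β, γ, hr, hγ, ?_, ?_⟩
  · rw [hAu x, hAu y, hAu z, phi0_eq, phi0_eq, hAcr, hAdot]
  · rw [hAu x, hAu y, hAu z, hAu w, star0_eq, star0_eq, hAcr, hAcr, hAdot, hAdot, hAdot, hAdot,
      hAdot]
  · rw [hmem', hAu x, ← hA6, hAdot]
    simp
  · rw [LinearEquiv.trans_apply, hz₁, map_smul, ← hA4, A.symm_apply_apply]
  · rw [LinearEquiv.trans_apply, hz₂, map_add, map_smul, map_smul, ← hA5, ← hA4,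
      A.symm_apply_apply, A.symm_apply_apply]

theorem compLinearMap_three_apply {V W : Type*} [AddCommGroup V] [Module ℝ V] [AddCommGroup W]
    [Module ℝ W] (φ : W [⋀^Fin 3]→ₗ[ℝ] ℝ) (f : V →ₗ[ℝ] W) (x y z : V) :
    φ.compLinearMap f ![x, y, z] = φ ![f x, f y, f z] := by
  rw [AlternatingMap.compLinearMap_apply]
  congr 1; ext i; fin_cases i <;> rfl

theorem compLinearMap_four_apply {V W : Type*} [AddCommGroup V] [Module ℝ V] [AddCommGroup W]
    [Module ℝ W] (φ : W [⋀^Fin 4]→ₗ[ℝ] ℝ) (f : V →ₗ[ℝ] W) (x y z w : V) :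
    φ.compLinearMap f ![x, y, z, w] = φ ![f x, f y, f z, f w] := by
  rw [AlternatingMap.compLinearMap_apply]
  congr 1; ext i; fin_cases i <;> rfl

theorem exists_derived_basis {g : Type*} [LieRing g] [LieAlgebra ℝ g] (h : LieIdeal ℝ g)
    (e : ↥h ≃ₗ[ℝ] (Fin 6 → ℝ))
    (he : ∀ X Y : ↥h, e ⟨⁅(X : g), (Y : g)⁆, h.lie_mem Y.2⟩ = B28 (e X) (e Y)) :
    ∃ z₁ ∈ h, ∃ z₂ ∈ h, (∀ a b : ℝ, a • z₁ + b • z₂ = 0 → a = 0 ∧ b = 0) ∧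
      (∀ x ∈ h, ∀ y ∈ h, ∃ p q : ℝ, ⁅x, y⁆ = p • z₁ + q • z₂) ∧
      (∀ x ∈ h, ⁅x, z₁⁆ = 0) ∧ (∀ x ∈ h, ⁅x, z₂⁆ = 0) ∧
      (∀ w : g, ∃ p q : ℝ, ⁅z₁, w⁆ = p • z₁ + q • z₂) ∧
      ∀ w : g, ∃ p q : ℝ, ⁅z₂, w⁆ = p • z₁ + q • z₂ := by
  let b (i : Fin 6) : g := e.symm (Pi.single i 1)
  have hb (i) : b i ∈ h := (e.symm _).2
  have hbr (x : g) (hx : x ∈ h) (y : g) (hy : y ∈ h) :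
      ⁅x, y⁆ = B28 (e ⟨x, hx⟩) (e ⟨y, hy⟩) 4 • b 4 + B28 (e ⟨x, hx⟩) (e ⟨y, hy⟩) 5 • b 5 := by
    have h₁ := congrArg (fun v => (e.symm v : g)) (he ⟨x, hx⟩ ⟨y, hy⟩)
    simp only [LinearEquiv.symm_apply_apply] at h₁
    rw [h₁]
    have h₂ : B28 (e ⟨x, hx⟩) (e ⟨y, hy⟩) = B28 (e ⟨x, hx⟩) (e ⟨y, hy⟩) 4 • Pi.single 4 1 +
        B28 (e ⟨x, hx⟩) (e ⟨y, hy⟩) 5 • Pi.single 5 1 := by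
      ext i; fin_cases i <;> simp [B28]
    conv_lhs => rw [h₂, map_add, map_smul, map_smul]
    rfl
  have hbb (i j) : ⁅b i, b j⁆ = B28 (Pi.single i 1) (Pi.single j 1) 4 • b 4 +
      B28 (Pi.single i 1) (Pi.single j 1) 5 • b 5 := by
    rw [hbr _ (hb i) _ (hb j)]
    simp [b]
  have hstab (x) (hx : x ∈ h) (y) (hy : y ∈ h) (w : g) :
      ∃ p q : ℝ, ⁅⁅x, y⁆, w⁆ = p • b 4 + q • b 5 := by
    rw [lie_lie, hbr _ hx _ (lie_mem_left ℝ g h y w hy), hbr _ hy _ (lie_mem_left ℝ g h x w hx)]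
    exact ⟨_, _, by rw [add_sub_add_comm, ← sub_smul, ← sub_smul]⟩
  refine ⟨b 4, hb 4, b 5, hb 5, fun p q hpq => ?_, fun x hx y hy => ⟨_, _, hbr x hx y hy⟩,
    fun x hx => ?_, fun x hx => ?_, fun w => ?_, fun w => ?_⟩
  · have h₀ : p • e.symm (Pi.single 4 1) + q • e.symm (Pi.single 5 1) = 0 := Subtype.ext hpq
    have h₁ := congrArg e h₀
    simp only [map_add, map_smul, LinearEquiv.apply_symm_apply, map_zero] at h₁
    exact ⟨by simpa using congrFun h₁ 4, by simpa using congrFun h₁ 5⟩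
  · rw [hbr x hx _ (hb 4)]
    simp [b, B28]
  · rw [hbr x hx _ (hb 5)]
    simp [b, B28]
  · have := hbb 2 0
    simp [B28] at this
    rw [← this]
    simpa only [this] using hstab _ (hb 2) _ (hb 0) w
  · have := hbb 3 0
    simp [B28] at this
    rw [← this]
    simpa only [this] using hstab _ (hb 3) _ (hb 0) w

theorem no_closed_eigenform_of_ideal {g : Type*} [LieRing g] [LieAlgebra ℝ g] (h : LieIdeal ℝ g)
    (hco : ∃ e7 : g, e7 ∉ h ∧ ∀ x : g, ∃ y ∈ h, ∃ t : ℝ, x = y + t • e7)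
    (e : ↥h ≃ₗ[ℝ] (Fin 6 → ℝ))
    (he : ∀ X Y : ↥h, e ⟨⁅(X : g), (Y : g)⁆, h.lie_mem Y.2⟩ = B28 (e X) (e Y))
    (u : g ≃ₗ[ℝ] (Fin 7 → ℝ)) (τ : g [⋀^Fin 2]→ₗ[ℝ] ℝ) (μ : ℝ) (hμ : μ ≠ 0)
    (hp : ∀ x y z w : g, d3CE (fun a b => ⁅a, b⁆) (phi0.compLinearMap u.toLinearMap) x y z w = 0)
    (hs : ∀ a b c d e : g,
      d4CE (fun a b => ⁅a, b⁆) (star0.compLinearMap u.toLinearMap) a b c d e =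
        (aw τ (phi0.compLinearMap u.toLinearMap) : g [⋀^Fin 5]→ₗ[ℝ] ℝ) ![a, b, c, d, e])
    (ht : ∀ x y z : g, d2CE (fun a b => ⁅a, b⁆) τ x y z =
      μ * phi0.compLinearMap u.toLinearMap ![x, y, z]) : False := by
  obtain ⟨z₁, hz₁, z₂, hz₂, hind, hder, hc₁, hc₂, hs₁, hs₂⟩ := exists_derived_basis h e he
  simp only [d2CE, compLinearMap_three_apply, LinearEquiv.coe_coe] at ht
  simp only [d3CE, compLinearMap_three_apply, LinearEquiv.coe_coe] at hp
  simp only [d4CE, aw_two_three_apply', compLinearMap_three_apply, compLinearMap_four_apply,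
    LinearEquiv.coe_coe] at hs
  have hτ0 (y : g) : τ ![0, y] = 0 := τ.map_coord_zero (0 : Fin 2) rfl
  have hφ (x : g) (hx : x ∈ h) : phi0 ![u z₁, u z₂, u x] = 0 := by
    have := ht z₁ z₂ x
    rw [hc₂ z₁ hz₁, ← lie_skew z₁ x, ← lie_skew z₂ x, hc₁ x hx, hc₂ x hx, neg_zero, hτ0, hτ0,
      hτ0] at this
    simpa [hμ] using this.symm
  obtain ⟨u', hu₃, hu₄, hmem, r, β, γ, hr, hγ, hu₁, hu₂⟩ :=
    exists_adapted_coordinates h.toSubmodule hco u hz₁ hind hφ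
  simp only [hu₃] at ht hp hs
  simp only [hu₄] at hs
  let b (i : Fin 7) : g := u'.symm (Pi.single i 1)
  have hub (i) : u' (b i) = Pi.single i 1 := u'.apply_symm_apply _
  have hbmem (i : Fin 7) (hi : i < 6) : b i ∈ h := by
    refine (hmem (b i)).mpr ?_
    rw [hub, Pi.single_eq_of_ne hi.ne']
  have hb4 : b 4 = r⁻¹ • z₁ := by
    apply u'.injective
    rw [hub, map_smul, hu₁, smul_smul, inv_mul_cancel₀ hr, one_smul]
  have hb5 : b 5 = γ⁻¹ • z₂ - (γ⁻¹ * β * r⁻¹) • z₁ := by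
    apply u'.injective
    rw [hub, map_sub, map_smul, map_smul, hu₁, hu₂, smul_add, smul_smul, smul_smul, smul_smul,
      inv_mul_cancel₀ hγ, mul_assoc _ r⁻¹ r, inv_mul_cancel₀ hr]
    module
  have hsupp (x : g) (hx : ∃ p q : ℝ, x = p • z₁ + q • z₂) (m : Fin 7) (hm : m < 4 ∨ m = 6) :
      u' x m = 0 := by
    obtain ⟨p, q, rfl⟩ := hx
    have h4 : m ≠ 4 := by rintro rfl; revert hm; decide
    have h5 : m ≠ 5 := by rintro rfl; revert hm; decide
    simp [hu₁, hu₂, h4, h5]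
  have hsum (x : g) : x = ∑ m, u' x m • b m := by
    have := map_eq_sum_single u'.symm.toLinearMap (u' x)
    simpa using this
  have hlie (x : g) (k n : Fin 7) : u' ⁅x, b k⁆ n = ∑ m, u' x m * u' ⁅b m, b k⁆ n := by
    conv_lhs => rw [hsum x]
    simp [sum_lie]
  have hlie' (x : g) (k n : Fin 7) : u' ⁅b k, x⁆ n = ∑ m, u' x m * u' ⁅b k, b m⁆ n := by
    conv_lhs => rw [hsum x]
    simp [lie_sum]
  have hτ (x y : g) : τ ![x, y] = ∑ m, u' x m * τ ![b m, y] := by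
    obtain ⟨f, hf⟩ : ∃ f : g →ₗ[ℝ] ℝ, ∀ v, f v = τ ![v, y] := by
      refine ⟨τ.toMultilinearMap.toLinearMap ![0, y] 0, fun v => ?_⟩
      change τ (Function.update ![0, y] 0 v) = _
      congr 1; ext i; fin_cases i <;> rfl
    rw [← hf]
    conv_lhs => rw [hsum x]
    simp only [map_sum, map_smul, smul_eq_mul]
    simp only [hf]
  refine structure_constants_contradiction (fun i j => u' ⁅b i, b j⁆) (fun i j => τ ![b i, b j]) μ hμ
    (fun i j => ?_) (fun i j => map_swap_two τ _ _) (fun i j m hi hj hm => ?_) (fun i j hi hj => ?_)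
    (fun i hi => ?_) (fun i m hi hm => ?_) (fun i j k n => ?_) (fun x y z w => ?_)
    (fun a b' c d e => ?_) (fun x y z => ?_)
  · rw [← map_neg, lie_skew]
  · exact hsupp _ (hder _ (hbmem i (hi.trans (by decide))) _ (hbmem j (hj.trans (by decide)))) m hm
  · rcases hj with rfl | rfl
    · rw [hb4, lie_smul, hc₁ _ (hbmem i hi), smul_zero, map_zero]
    · rw [hb5, lie_sub, lie_smul, lie_smul, hc₁ _ (hbmem i hi), hc₂ _ (hbmem i hi), smul_zero,
        smul_zero, sub_zero, map_zero]
  · exact (hmem _).mp (lie_mem_left ℝ g h (b i) (b 6) (hbmem i hi))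
  · refine hsupp _ ?_ m (.inl hm)
    obtain ⟨p₁, q₁, h₁⟩ := hs₁ (b 6)
    obtain ⟨p₂, q₂, h₂⟩ := hs₂ (b 6)
    rcases hi with rfl | rfl
    · exact ⟨r⁻¹ * p₁, r⁻¹ * q₁, by rw [hb4, smul_lie, h₁]; module⟩
    · exact ⟨γ⁻¹ * p₂ - γ⁻¹ * β * r⁻¹ * p₁, γ⁻¹ * q₂ - γ⁻¹ * β * r⁻¹ * q₁, by
        rw [hb5, sub_lie, smul_lie, smul_lie, h₁, h₂]; module⟩
  · rw [← hlie ⁅b i, b j⁆ k n, ← hlie ⁅b i, b k⁆ j n, ← hlie' ⁅b j, b k⁆ i n, lie_lie,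
      ← Pi.add_apply, ← map_add, ← lie_skew (b j) ⁅b i, b k⁆]
    abel_nf
  · simpa only [hub] using hp (b x) (b y) (b z) (b w)
  · simpa only [hub] using hs (b a) (b b') (b c) (b d) (b e)
  · have := ht (b x) (b y) (b z)
    rw [hub, hub, hub, hτ ⁅b x, b y⁆, hτ ⁅b x, b z⁆, hτ ⁅b y, b z⁆] at this
    exact this

/-!  STATEMENT 19.  First part: there is no derivation `f` of `n₂₈`, no `λ ≠ 0`, no
`c ∈ ℝ` and no `β ∈ span{e¹,…,e⁴}` such that, with `ω = λ²ω₀`, `ρ = λ³ρ₀` and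
`ν = ce¹² + (λ³−c)e³⁴ + λ³e⁵⁶ + e⁵∧β + e⁶∧J₀*β`, the equations `f.ν = ω` and
`ω ∧ (f.ω − ν) = dρ̂` hold (with `ρ̂ = λ³(e¹³⁵ − e¹⁴⁶ − e²³⁶ − e²⁴⁵)`).
Second part (consequence): no almost nilpotent Lie algebra with codimension-one
nilpotent ideal isomorphic to `n₂₈` admits a closed `G₂`-eigenform: i.e. there is no
`G₂`-structure `φ` with compatible `⋆_φφ = star4` (encoded by an adapted isomorphism),
closed (`dφ = 0`), whose torsion two-form `τ` (characterised by `d⋆_φφ = τ ∧ φ`, and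
satisfying `Δ_φφ = dτ`) obeys `dτ = μφ` for some `μ ≠ 0`. -/
theorem no_closed_g2_eigenform_with_ideal_n28 :
    (∀ (f : (Fin 6 → ℝ) →ₗ[ℝ] (Fin 6 → ℝ)),
      (∀ x y : Fin 6 → ℝ, f (B28 x y) = B28 (f x) y + B28 x (f y)) →
      ∀ (lam : ℝ), lam ≠ 0 → ∀ (c : ℝ) (β : Module.Dual ℝ (Fin 6 → ℝ)),
      β (Pi.single 4 1) = 0 → β (Pi.single 5 1) = 0 →
      ¬ ((∀ x y : Fin 6 → ℝ,
            -(nu19 lam c β ![f x, y]) - nu19 lam c β ![x, f y] = om19 lam ![x, y]) ∧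
         (∀ x y z w : Fin 6 → ℝ,
            sh2 (fun a b => om19 lam ![a, b])
              (fun a b => fdot2 f (om19 lam) a b - nu19 lam c β ![a, b]) x y z w =
            d3CE B28 (rhh19 lam) x y z w))) ∧
    (∀ (g : Type) [LieRing g] [LieAlgebra ℝ g] (h : LieIdeal ℝ g),
      (∃ e7 : g, e7 ∉ h ∧ ∀ x : g, ∃ y ∈ h, ∃ t : ℝ, x = y + t • e7) →
      (∃ e : ↥h ≃ₗ[ℝ] (Fin 6 → ℝ),
        ∀ X Y : ↥h, e ⟨⁅(X : g), (Y : g)⁆, h.lie_mem Y.2⟩ = B28 (e X) (e Y)) →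
      ¬ ∃ (φ : g [⋀^Fin 3]→ₗ[ℝ] ℝ) (star4 : g [⋀^Fin 4]→ₗ[ℝ] ℝ)
          (τ : g [⋀^Fin 2]→ₗ[ℝ] ℝ) (μ : ℝ),
          μ ≠ 0 ∧
          (∃ u : g ≃ₗ[ℝ] (Fin 7 → ℝ), φ = phi0.compLinearMap u.toLinearMap ∧
            star4 = star0.compLinearMap u.toLinearMap) ∧
          (∀ x y z w : g, d3CE (fun a b => ⁅a, b⁆) φ x y z w = 0) ∧
          (∀ v₀ v₁ v₂ v₃ v₄ : g, d4CE (fun a b => ⁅a, b⁆) star4 v₀ v₁ v₂ v₃ v₄ =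
            (aw τ φ : g [⋀^Fin 5]→ₗ[ℝ] ℝ) ![v₀, v₁, v₂, v₃, v₄]) ∧
          (∀ x y z : g, d2CE (fun a b => ⁅a, b⁆) τ x y z = μ * φ ![x, y, z])) := by
  refine ⟨fun f hf lam hlam c β h₄ h₅ ⟨_, h₂⟩ =>
    no_derivation_n28 f hf lam hlam c β h₄ h₅ h₂, ?_⟩
  rintro g _ _ h hco ⟨e, he⟩ ⟨φ, star4, τ, μ, hμ, ⟨u, rfl, rfl⟩, hp, hs, ht⟩
  exact no_closed_eigenform_of_ideal h hco e he u τ μ hμ hp hs ht
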